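/- arXiv:1311.2298 — 2 statements merged into one kernel-verified Lean document; each statement's English description precedes it below -/
import Mathlib

section
/- Let ℬ be a simply rooted family in 𝒫(n) with |ℬ| = m, and let p ∈ [0,1]. Suppose that |ℬ_{{i}}| ≤ p·m for all i ∈ [n]. Then ‖ℬ‖ ≤ ‖I(m)‖ + m − m²(1/8 − p²/8)/2^n. -/
open Finset
open scoped Classical

/-- The total size `‖𝒜‖ = Σ_{A∈𝒜} |A|` of a family of finite sets. -/
def totalSize (𝒜 : Finset (Finset ℕ)) : ℕ := ∑ A ∈ 𝒜, A.card

/-- A family is union-closed if it is closed under pairwise unions. -/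
def UnionClosed (𝒜 : Finset (Finset ℕ)) : Prop := ∀ A ∈ 𝒜, ∀ B ∈ 𝒜, A ∪ B ∈ 𝒜

/-- The `k`-th finite set of positive integers in the colex order: the positive
integer `i` belongs to it iff bit `i - 1` of `k` is set. -/
def colexSet (k : ℕ) : Finset ℕ :=
  ((Finset.range (k + 1)).filter fun i => k.testBit i).image (· + 1)

/-- The initial segment `I(m)` of length `m` of the colex order on finite sets
of positive integers. -/
def colexInit (m : ℕ) : Finset (Finset ℕ) := (Finset.range m).image colexSet

/-- A family `ℬ` is simply rooted if every nonempty `B ∈ ℬ` has some `b ∈ B`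
with the whole cube `[{b}, B]` contained in `ℬ`. -/
def SimplyRooted (ℬ : Finset (Finset ℕ)) : Prop :=
  ∀ B ∈ ℬ, B.Nonempty → ∃ b ∈ B, ∀ C : Finset ℕ, {b} ⊆ C → C ⊆ B → C ∈ ℬ

/-- `B` is `ℬ`-rooted at `i`: `i ∈ B` and the cube `[{i}, B]` lies in `ℬ`. -/
def RootedAt (ℬ : Finset (Finset ℕ)) (B : Finset ℕ) (i : ℕ) : Prop :=
  i ∈ B ∧ ∀ C : Finset ℕ, {i} ⊆ C → C ⊆ B → C ∈ ℬ

/-- `ℬ_S`: the sets of `ℬ` that are `ℬ`-rooted at some element of `S`. -/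
noncomputable def rootedFam (ℬ : Finset (Finset ℕ)) (S : Finset ℕ) : Finset (Finset ℕ) :=
  ℬ.filter fun B => ∃ i ∈ S, RootedAt ℬ B i

/-- The image of a single set `B` under the down-compression of `ℬ` in
direction `i`. -/
def compressSet (ℬ : Finset (Finset ℕ)) (i : ℕ) (B : Finset ℕ) : Finset ℕ :=
  if i ∈ B ∧ B.erase i ∉ ℬ then B.erase i else B

/-- The down-compression `d_i(ℬ)` of the family `ℬ` in direction `i`. -/
def dComp (i : ℕ) (ℬ : Finset (Finset ℕ)) : Finset (Finset ℕ) :=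
  ℬ.image (compressSet ℬ i)

/-- `D_k(ℬ) = d_k(⋯ d_1(ℬ) ⋯)`.  In particular `d(ℬ) = D_n(ℬ)` for
`ℬ ⊆ 𝒫(n)`. -/
def DComp : ℕ → Finset (Finset ℕ) → Finset (Finset ℕ)
  | 0, ℬ => ℬ
  | k + 1, ℬ => dComp (k + 1) (DComp k ℬ)

/-- `D_{(ℬ,k)}(B)`: the image of the set `B` obtained by following `B` through
the successive compressions `d_1, …, d_k`.  In particular `d_ℬ(B) = D_{(ℬ,n)}(B)`
for `ℬ ⊆ 𝒫(n)`. -/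
def DCompSet : ℕ → Finset (Finset ℕ) → Finset ℕ → Finset ℕ
  | 0, _, B => B
  | k + 1, ℬ, B => compressSet (DComp k ℬ) (k + 1) (DCompSet k ℬ B)

/-- The shadow `δB = {B \ {i} : i ∈ B}` of a finite set `B`. -/
def shadowSet (B : Finset ℕ) : Finset (Finset ℕ) := B.image fun i => B.erase i

/-- `B` is a bad set of `ℬ ⊆ 𝒫(n)` if `δB ⊆ ℬ` or `d_ℬ(B) = B`. -/
def BadSet (n : ℕ) (ℬ : Finset (Finset ℕ)) (B : Finset ℕ) : Prop :=
  shadowSet B ⊆ ℬ ∨ DCompSet n ℬ B = B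

/-- A family is a down-set if it is closed under taking subsets. -/
def IsDownSet (𝒟 : Finset (Finset ℕ)) : Prop := ∀ A ∈ 𝒟, ∀ B ⊆ A, B ∈ 𝒟

/-- The deficiency `def(ℬ) = Σ_{B∈ℬ} |δB \ ℬ|`. -/
def deficiency (ℬ : Finset (Finset ℕ)) : ℕ := ∑ B ∈ ℬ, (shadowSet B \ ℬ).card

/-- `𝒜 ⊆ 𝒫(n)` is a counterexample to the union-closed conjecture:
union-closed, not `{∅}`, and every element of `[n]` has degree `< |𝒜|/2`. -/
def UCCounterexample (n : ℕ) (𝒜 : Finset (Finset ℕ)) : Prop :=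
  𝒜 ⊆ (Finset.Icc 1 n).powerset ∧ UnionClosed 𝒜 ∧ 𝒜 ≠ {∅} ∧
    ∀ i ∈ Finset.Icc 1 n, ((𝒜.filter fun A => i ∈ A).card : ℚ) < (𝒜.card : ℚ) / 2

theorem mem_colexSet {k x : ℕ} : x ∈ colexSet k ↔ ∃ i, k.testBit i = true ∧ i + 1 = x := by
  simp only [colexSet, mem_image, mem_filter, mem_range]
  constructor
  · rintro ⟨i, ⟨-, h⟩, rfl⟩
    exact ⟨i, h, rfl⟩
  · rintro ⟨i, h, rfl⟩
    refine ⟨i, ⟨?_, h⟩, rfl⟩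
    have h1 := Nat.ge_two_pow_of_testBit h
    have h2 := Nat.lt_two_pow_self (n := i)
    omega

theorem colexSet_injective : Function.Injective colexSet := by
  intro a b h
  apply Nat.eq_of_testBit_eq
  intro i
  have h1 : i + 1 ∈ colexSet a ↔ i + 1 ∈ colexSet b := by rw [h]
  simp only [mem_colexSet, add_left_inj, exists_eq_right] at h1
  exact Bool.eq_iff_iff.2 h1

theorem card_colexSet_two_mul (k : ℕ) : (colexSet (2 * k)).card = (colexSet k).card := by
  have : colexSet (2 * k) = (colexSet k).image (· + 1) := by
    ext x
    simp only [mem_image, mem_colexSet]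
    constructor
    · rintro ⟨i, h, rfl⟩
      cases i with
      | zero => simp at h
      | succ i => exact ⟨i + 1, ⟨i, by simpa [Nat.testBit_succ] using h, rfl⟩, rfl⟩
    · rintro ⟨_, ⟨i, h, rfl⟩, rfl⟩
      exact ⟨i + 1, by simpa [Nat.testBit_succ] using h, rfl⟩
  rw [this, card_image_of_injective _ (add_left_injective 1)]

theorem card_colexSet_two_mul_add_one (k : ℕ) :
    (colexSet (2 * k + 1)).card = (colexSet k).card + 1 := by
  have : colexSet (2 * k + 1) = insert 1 ((colexSet k).image (· + 1)) := by
    ext x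
    simp only [mem_insert, mem_image, mem_colexSet]
    constructor
    · rintro ⟨i, h, rfl⟩
      cases i with
      | zero => simp
      | succ i =>
        refine Or.inr ⟨i + 1, ⟨i, ?_, rfl⟩, rfl⟩
        rw [Nat.testBit_succ] at h
        rwa [show (2 * k + 1) / 2 = k by omega] at h
    · rintro (rfl | ⟨_, ⟨i, h, rfl⟩, rfl⟩)
      · exact ⟨0, by simp, rfl⟩
      · refine ⟨i + 1, ?_, rfl⟩
        rw [Nat.testBit_succ, show (2 * k + 1) / 2 = k by omega]
        exact h
  rw [this, card_insert_of_notMem, card_image_of_injective _ (add_left_injective 1)]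
  simp [mem_colexSet]

theorem totalSize_colexInit (m : ℕ) :
    totalSize (colexInit m) = ∑ k ∈ range m, (colexSet k).card := by
  rw [totalSize, colexInit, sum_image fun _ _ _ _ h => colexSet_injective h]

theorem totalSize_colexInit_two_mul (m : ℕ) :
    totalSize (colexInit (2 * m)) = 2 * totalSize (colexInit m) + m := by
  simp only [totalSize_colexInit]
  induction m with
  | zero => simp
  | succ m ih =>
    rw [show 2 * (m + 1) = 2 * m + 1 + 1 by ring, sum_range_succ, sum_range_succ, ih,
      card_colexSet_two_mul, card_colexSet_two_mul_add_one, sum_range_succ]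
    ring

theorem totalSize_colexInit_two_mul_add_one (m : ℕ) :
    totalSize (colexInit (2 * m + 1)) =
      totalSize (colexInit m) + totalSize (colexInit (m + 1)) + m := by
  have h := totalSize_colexInit_two_mul m
  simp only [totalSize_colexInit] at h ⊢
  rw [sum_range_succ, h, card_colexSet_two_mul, sum_range_succ]
  ring

/-- Superadditivity of the total size of colex initial segments. -/
theorem totalSize_colexInit_add_le (a b : ℕ) (hba : b ≤ a) :
    totalSize (colexInit a) + totalSize (colexInit b) + b ≤ totalSize (colexInit (a + b)) := by
  induction hs : a + b using Nat.strong_induction_on generalizing a b with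
  | _ s ih =>
    subst hs
    have IH : ∀ c d, c + d < a + b → d ≤ c →
        totalSize (colexInit c) + totalSize (colexInit d) + d ≤ totalSize (colexInit (c + d)) :=
      fun c d h1 h2 => ih _ h1 c d h2 rfl
    rcases Nat.eq_zero_or_pos b with rfl | hb
    · simp [totalSize_colexInit]
    rcases Nat.even_or_odd' a with ⟨x, rfl | rfl⟩ <;> rcases Nat.even_or_odd' b with ⟨y, rfl | rfl⟩
    · have h1 := IH x y (by omega) (by omega)
      rw [← mul_add]
      simp only [totalSize_colexInit_two_mul]
      omega
    · have h1 := IH x y (by omega) (by omega)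
      have h2 := IH x (y + 1) (by omega) (by omega)
      rw [show 2 * x + (2 * y + 1) = 2 * (x + y) + 1 by ring]
      simp only [totalSize_colexInit_two_mul, totalSize_colexInit_two_mul_add_one]
      rw [← add_assoc x y 1] at h2
      omega
    · have h1 := IH x y (by omega) (by omega)
      have h2 := IH (x + 1) y (by omega) (by omega)
      rw [show 2 * x + 1 + 2 * y = 2 * (x + y) + 1 by ring]
      simp only [totalSize_colexInit_two_mul, totalSize_colexInit_two_mul_add_one]
      rw [add_right_comm x 1 y] at h2
      omega
    · rw [show 2 * x + 1 + (2 * y + 1) = 2 * (x + y + 1) by ring]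
      simp only [totalSize_colexInit_two_mul, totalSize_colexInit_two_mul_add_one]
      rcases (show y ≤ x by omega).eq_or_lt with rfl | hlt
      · by_cases hy : y = 0
        · subst hy
          simp [totalSize_colexInit, colexSet]
        have h1 := IH (y + 1) y (by omega) (by omega)
        rw [add_right_comm y 1 y] at h1
        omega
      · have h1 := IH (x + 1) y (by omega) (by omega)
        have h2 := IH x (y + 1) (by omega) (by omega)
        rw [add_right_comm x 1 y] at h1
        rw [← add_assoc x y 1] at h2
        omega

/-- The number of pairs `(A, A \ {i})` with `i ∈ A` and both sets in `𝒜`. -/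
noncomputable def innerEdges (𝒜 : Finset (Finset ℕ)) : ℕ :=
  ∑ A ∈ 𝒜, (A.filter fun i => A.erase i ∈ 𝒜).card

theorem innerEdges_eq (a : ℕ) (𝒜 : Finset (Finset ℕ)) :
    innerEdges 𝒜 = innerEdges (𝒜.nonMemberSubfamily a) + innerEdges (𝒜.memberSubfamily a) +
      (𝒜.nonMemberSubfamily a ∩ 𝒜.memberSubfamily a).card := by
  have hsplit := sum_filter_add_sum_filter_not 𝒜 (fun A => a ∈ A)
    (fun A => (A.filter fun i => A.erase i ∈ 𝒜).card)
  have h0 : ∑ A ∈ 𝒜.filter (fun A => a ∉ A), (A.filter fun i => A.erase i ∈ 𝒜).card =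
      innerEdges (𝒜.nonMemberSubfamily a) := by
    rw [innerEdges, nonMemberSubfamily]
    refine sum_congr (by congr) fun A hA => ?_
    have hA' : a ∉ A := (mem_filter.1 hA).2
    congr 1
    ext i
    simp only [mem_filter, mem_erase]
    tauto
  have h1 : ∑ A ∈ 𝒜.filter (fun A => a ∈ A), (A.filter fun i => A.erase i ∈ 𝒜).card =
      innerEdges (𝒜.memberSubfamily a) +
      (𝒜.nonMemberSubfamily a ∩ 𝒜.memberSubfamily a).card := by
    have himg : 𝒜.filter (fun A => a ∈ A) = (𝒜.memberSubfamily a).image (insert a) := by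
      ext A
      simp only [mem_filter, mem_image, mem_memberSubfamily]
      constructor
      · rintro ⟨hA, ha⟩
        exact ⟨A.erase a, ⟨by rwa [insert_erase ha], notMem_erase a A⟩, insert_erase ha⟩
      · rintro ⟨B, ⟨hB, -⟩, rfl⟩
        exact ⟨hB, mem_insert_self a B⟩
    rw [himg, sum_image, innerEdges, inter_comm, ← filter_mem_eq_inter, card_filter,
      ← sum_add_distrib]
    · refine sum_congr rfl fun B hB => ?_
      obtain ⟨hB, haB⟩ := mem_memberSubfamily.1 hB
      have hmem : B ∈ 𝒜.nonMemberSubfamily a ↔ (insert a B).erase a ∈ 𝒜 := by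
        rw [mem_nonMemberSubfamily, erase_insert haB]
        tauto
      have hrest : (B.filter fun i => (insert a B).erase i ∈ 𝒜) =
          B.filter fun i => B.erase i ∈ 𝒜.memberSubfamily a := by
        refine filter_congr fun i hi => ?_
        have hia : a ≠ i := fun h => haB (h ▸ hi)
        rw [mem_memberSubfamily, erase_insert_of_ne hia]
        simp [haB]
      rw [filter_insert, hrest]
      by_cases h : (insert a B).erase a ∈ 𝒜
      · rw [if_pos h, if_pos (hmem.2 h), card_insert_of_notMem (by simp [haB])]
      · rw [if_neg h, if_neg (fun h' => h (hmem.1 h')), add_zero]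
    · intro B hB C hC h
      have hB' := (mem_memberSubfamily.1 hB).2
      have hC' := (mem_memberSubfamily.1 hC).2
      rw [← erase_insert hB', ← erase_insert hC', h]
  rw [h0, h1] at hsplit
  rw [innerEdges, ← hsplit]
  ring

/-- The edge-isoperimetric inequality in the cube. -/
theorem innerEdges_le (s : Finset ℕ) (𝒜 : Finset (Finset ℕ)) (h𝒜 : ∀ A ∈ 𝒜, A ⊆ s) :
    innerEdges 𝒜 ≤ totalSize (colexInit 𝒜.card) := by
  induction s using Finset.induction_on generalizing 𝒜 with
  | empty =>
    refine le_trans (le_of_eq ?_) (Nat.zero_le _)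
    refine sum_eq_zero fun A hA => ?_
    simp [subset_empty.1 (h𝒜 A hA)]
  | insert a s ha ih =>
    have h0 := ih (𝒜.nonMemberSubfamily a) fun A hA => by
      obtain ⟨h1, h2⟩ := mem_nonMemberSubfamily.1 hA
      exact (subset_insert_iff_of_notMem h2).1 (h𝒜 A h1)
    have h1 := ih (𝒜.memberSubfamily a) fun A hA => by
      obtain ⟨h1, h2⟩ := mem_memberSubfamily.1 hA
      exact (subset_insert_iff_of_notMem h2).1 ((subset_insert a A).trans (h𝒜 _ h1))
    have hcard := card_memberSubfamily_add_card_nonMemberSubfamily a 𝒜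
    have hi0 := card_le_card (inter_subset_left (s₁ := 𝒜.nonMemberSubfamily a)
      (s₂ := 𝒜.memberSubfamily a))
    have hi1 := card_le_card (inter_subset_right (s₁ := 𝒜.nonMemberSubfamily a)
      (s₂ := 𝒜.memberSubfamily a))
    rw [innerEdges_eq a, ← hcard]
    rcases le_total (𝒜.memberSubfamily a).card (𝒜.nonMemberSubfamily a).card with h | h
    · have := totalSize_colexInit_add_le _ _ h
      rw [add_comm (𝒜.memberSubfamily a).card]
      omega
    · have := totalSize_colexInit_add_le _ _ h
      omega

open scoped FinsetFamily

/-- The sets `P` such that some `i ∉ P` roots `P ∪ {i}` in `ℬ`. -/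
noncomputable def unrooted (ℬ : Finset (Finset ℕ)) : Finset (Finset ℕ) :=
  ℬ.biUnion fun B => (B.filter (RootedAt ℬ B)).image B.erase

/-- The members of `ℬ` all of whose subsets belong to `ℬ`. -/
noncomputable def downCore (ℬ : Finset (Finset ℕ)) : Finset (Finset ℕ) :=
  ℬ.filter fun B => ∀ C ⊆ B, C ∈ ℬ

theorem RootedAt.mem {ℬ : Finset (Finset ℕ)} {B : Finset ℕ} {i : ℕ} (h : RootedAt ℬ B i) :
    B ∈ ℬ :=
  h.2 B (singleton_subset_iff.2 h.1) Subset.rfl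

theorem RootedAt.mono {ℬ : Finset (Finset ℕ)} {B C : Finset ℕ} {i : ℕ} (h : RootedAt ℬ B i)
    (hi : i ∈ C) (hCB : C ⊆ B) : RootedAt ℬ C i :=
  ⟨hi, fun D hD hDC => h.2 D hD (hDC.trans hCB)⟩

theorem RootedAt.mem_of_subset {ℬ : Finset (Finset ℕ)} {B C : Finset ℕ} {i : ℕ}
    (h : RootedAt ℬ B i) (hi : i ∈ C) (hCB : C ⊆ B) : C ∈ ℬ :=
  (h.mono hi hCB).mem

theorem rootedAt_insert {ℬ : Finset (Finset ℕ)} {P : Finset ℕ} {i : ℕ} :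
    RootedAt ℬ (insert i P) i ↔ ∀ C ⊆ P, insert i C ∈ ℬ := by
  constructor
  · intro h C hC
    exact h.mem_of_subset (mem_insert_self i C) (insert_subset_insert i hC)
  · intro h
    refine ⟨mem_insert_self i P, fun C hC hCP => ?_⟩
    have hi : i ∈ C := singleton_subset_iff.1 hC
    rw [← insert_erase hi]
    exact h _ (subset_insert_iff.1 hCP)

theorem mem_unrooted {ℬ : Finset (Finset ℕ)} {P : Finset ℕ} :
    P ∈ unrooted ℬ ↔ ∃ i, i ∉ P ∧ RootedAt ℬ (insert i P) i := by
  simp only [unrooted, mem_biUnion, mem_image, mem_filter]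
  constructor
  · rintro ⟨B, hB, i, ⟨hi, h⟩, rfl⟩
    exact ⟨i, notMem_erase i B, by rwa [insert_erase hi]⟩
  · rintro ⟨i, hi, h⟩
    exact ⟨insert i P, h.mem, i, ⟨mem_insert_self i P, h⟩, erase_insert hi⟩

theorem mem_downCore {ℬ : Finset (Finset ℕ)} {P : Finset ℕ} :
    P ∈ downCore ℬ ↔ ∀ C ⊆ P, C ∈ ℬ := by
  simp only [downCore, mem_filter, and_iff_right_iff_imp]
  exact fun h => h P Subset.rfl

theorem isLowerSet_unrooted (ℬ : Finset (Finset ℕ)) :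
    IsLowerSet (unrooted ℬ : Set (Finset ℕ)) := by
  intro P Q hQP hP
  obtain ⟨i, hi, h⟩ := mem_unrooted.1 (mem_coe.1 hP)
  exact mem_coe.2 (mem_unrooted.2 ⟨i, fun h' => hi (hQP h'),
    h.mono (mem_insert_self i Q) (insert_subset_insert i hQP)⟩)

theorem mem_compression_iff_of_notMem {ℬ : Finset (Finset ℕ)} {P : Finset ℕ} {i : ℕ}
    (hi : i ∉ P) : P ∈ 𝓓 i ℬ ↔ P ∈ ℬ ∨ insert i P ∈ ℬ := by
  rw [Down.mem_compression, erase_eq_of_notMem hi]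
  tauto

theorem mem_compression_iff_of_mem {ℬ : Finset (Finset ℕ)} {P : Finset ℕ} {i : ℕ}
    (hi : i ∈ P) : P ∈ 𝓓 i ℬ ↔ P ∈ ℬ ∧ P.erase i ∈ ℬ := by
  rw [Down.mem_compression, insert_eq_of_mem hi]
  tauto

theorem RootedAt.compression {ℬ : Finset (Finset ℕ)} {B : Finset ℕ} {i j : ℕ} (hij : j ≠ i)
    (h : RootedAt ℬ B j) : RootedAt (𝓓 i ℬ) B j := by
  refine ⟨h.1, fun C hjC hCB => ?_⟩
  have hj := singleton_subset_iff.1 hjC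
  exact Down.mem_compression.2 (Or.inl ⟨h.2 C hjC hCB,
    h.mem_of_subset (mem_erase.2 ⟨hij, hj⟩) ((erase_subset i C).trans hCB)⟩)

theorem RootedAt.mem_downCore_compression {ℬ : Finset (Finset ℕ)} {P : Finset ℕ} {i : ℕ}
    (hi : i ∉ P) (h : RootedAt ℬ (insert i P) i) : P ∈ downCore (𝓓 i ℬ) :=
  mem_downCore.2 fun C hC => (mem_compression_iff_of_notMem fun h' => hi (hC h')).2
    (Or.inr (rootedAt_insert.1 h C hC))

theorem downCore_subset_compression (i : ℕ) (ℬ : Finset (Finset ℕ)) :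
    downCore ℬ ⊆ downCore (𝓓 i ℬ) := by
  intro P hP
  rw [mem_downCore] at hP ⊢
  exact fun C hC => Down.mem_compression.2
    (Or.inl ⟨hP C hC, hP _ ((erase_subset i C).trans hC)⟩)

theorem unrooted_union_downCore_subset_compression (i : ℕ) (ℬ : Finset (Finset ℕ)) :
    unrooted ℬ ∪ downCore ℬ ⊆ unrooted (𝓓 i ℬ) ∪ downCore (𝓓 i ℬ) := by
  refine union_subset (fun P hP => ?_)
    ((downCore_subset_compression i ℬ).trans subset_union_right)
  obtain ⟨j, hj, h⟩ := mem_unrooted.1 hP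
  by_cases hij : j = i
  · subst hij
    exact mem_union_right _ (h.mem_downCore_compression hj)
  · exact mem_union_left _ (mem_unrooted.2 ⟨j, hj, h.compression hij⟩)

/-- The new sets created by the down-compression of `ℬ` in direction `i`. -/
noncomputable def fallen (i : ℕ) (ℬ : Finset (Finset ℕ)) : Finset (Finset ℕ) :=
  𝓓 i ℬ \ ℬ

theorem mem_fallen {i : ℕ} {ℬ : Finset (Finset ℕ)} {P : Finset ℕ} :
    P ∈ fallen i ℬ ↔ i ∉ P ∧ P ∉ ℬ ∧ insert i P ∈ ℬ := by
  rw [fallen, mem_sdiff, Down.mem_compression]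
  constructor
  · rintro ⟨h | h, h'⟩
    · exact absurd h.1 h'
    · exact ⟨fun hi => h.1 (insert_eq_of_mem hi ▸ h.2), h⟩
  · rintro ⟨-, h⟩
    exact ⟨Or.inr h, h.1⟩

theorem totalSize_compression (i : ℕ) (ℬ : Finset (Finset ℕ)) :
    totalSize (𝓓 i ℬ) + (fallen i ℬ).card = totalSize ℬ := by
  have hnew : ∑ P ∈ fallen i ℬ, P.card + (fallen i ℬ).card = ∑ P ∈ ℬ \ 𝓓 i ℬ, P.card := by
    have himg : ℬ \ 𝓓 i ℬ = (fallen i ℬ).image (insert i) := by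
      ext A
      simp only [mem_sdiff, mem_image, mem_fallen]
      constructor
      · rintro ⟨hA, hA'⟩
        have hi : i ∈ A := by
          by_contra hi
          exact hA' ((mem_compression_iff_of_notMem hi).2 (Or.inl hA))
        rw [mem_compression_iff_of_mem hi] at hA'
        exact ⟨A.erase i, ⟨notMem_erase i A, fun h => hA' ⟨hA, h⟩, by rwa [insert_erase hi]⟩,
          insert_erase hi⟩
      · rintro ⟨P, ⟨hi, hP, hP'⟩, rfl⟩
        refine ⟨hP', fun h => hP ?_⟩
        rw [mem_compression_iff_of_mem (mem_insert_self i P), erase_insert hi] at h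
        exact h.2
    rw [himg, sum_image, card_eq_sum_ones, ← sum_add_distrib]
    · exact sum_congr rfl fun P hP => (card_insert_of_notMem (mem_fallen.1 hP).1).symm
    · intro P hP Q hQ h
      rw [← erase_insert (mem_fallen.1 hP).1, ← erase_insert (mem_fallen.1 hQ).1, h]
  have h1 := sum_sdiff (f := card) (inter_subset_left (s₁ := ℬ) (s₂ := 𝓓 i ℬ))
  have h2 := sum_sdiff (f := card) (inter_subset_right (s₁ := ℬ) (s₂ := 𝓓 i ℬ))
  rw [sdiff_inter_self_left] at h1
  rw [sdiff_inter_self_right] at h2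
  rw [fallen] at hnew ⊢
  simp only [totalSize]
  omega

theorem SimplyRooted.rootedAt_of_erase_notMem {ℬ : Finset (Finset ℕ)} (hsr : SimplyRooted ℬ)
    {B : Finset ℕ} {i : ℕ} (hB : B ∈ ℬ) (hi : i ∈ B) (h : B.erase i ∉ ℬ) : RootedAt ℬ B i := by
  obtain ⟨b, hb, hroot⟩ := hsr B hB ⟨i, hi⟩
  by_cases hbi : b = i
  · subst hbi
    exact ⟨hb, hroot⟩
  · exact absurd (hroot _ (singleton_subset_iff.2 (mem_erase.2 ⟨hbi, hb⟩)) (erase_subset i B)) h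

theorem SimplyRooted.rootedAt_insert_of_notMem {ℬ : Finset (Finset ℕ)} (hsr : SimplyRooted ℬ)
    {P : Finset ℕ} {i : ℕ} (hP : P ∉ ℬ) (h : insert i P ∈ ℬ) :
    RootedAt ℬ (insert i P) i := by
  have hi : i ∉ P := fun hi => hP (insert_eq_of_mem hi ▸ h)
  exact hsr.rootedAt_of_erase_notMem h (mem_insert_self i P) (by rwa [erase_insert hi])

theorem SimplyRooted.compression {ℬ : Finset (Finset ℕ)} (hsr : SimplyRooted ℬ) (i : ℕ) :
    SimplyRooted (𝓓 i ℬ) := by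
  intro Q hQ hne
  suffices ∃ b, RootedAt (𝓓 i ℬ) Q b from let ⟨b, hb, h⟩ := this; ⟨b, hb, h⟩
  by_cases hi : i ∈ Q
  · obtain ⟨hQ1, hQ2⟩ := (mem_compression_iff_of_mem hi).1 hQ
    obtain ⟨b, hb⟩ := hsr Q hQ1 hne
    by_cases hbi : b = i
    · subst hbi
      rcases (Q.erase b).eq_empty_or_nonempty with he | he
      · refine ⟨b, hi, fun C hbC hCQ => ?_⟩
        have : C = Q := Subset.antisymm hCQ fun x hx => by
          by_cases hx' : x = b
          · exact hx' ▸ singleton_subset_iff.1 hbC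
          · have := mem_erase.2 ⟨hx', hx⟩
            simp [he] at this
        rwa [this]
      · obtain ⟨c, hc, hroot⟩ := hsr _ hQ2 he
        have hcb := mem_erase.1 hc
        refine ⟨c, RootedAt.compression (ℬ := ℬ) hcb.1 ⟨hcb.2, fun C hcC hCQ => ?_⟩⟩
        by_cases hbC : b ∈ C
        · exact hb.2 C (singleton_subset_iff.2 hbC) hCQ
        · exact hroot C hcC (subset_erase.2 ⟨hCQ, hbC⟩)
    · exact ⟨b, RootedAt.compression hbi hb⟩
  · by_cases hQ1 : Q ∈ ℬ
    · obtain ⟨b, hb⟩ := hsr Q hQ1 hne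
      exact ⟨b, RootedAt.compression (fun h => hi (h ▸ hb.1)) hb⟩
    · have hQ2 := ((mem_compression_iff_of_notMem hi).1 hQ).resolve_left hQ1
      have h := (hsr.rootedAt_insert_of_notMem hQ1 hQ2).mem_downCore_compression hi
      obtain ⟨b, hb⟩ := hne
      exact ⟨b, hb, fun C _ hC => mem_downCore.1 h C hC⟩

/-- Compression creates no new rooted cubes outside the down-closed core. -/
theorem SimplyRooted.unrooted_compression_subset {ℬ : Finset (Finset ℕ)} (hsr : SimplyRooted ℬ)
    (i : ℕ) : unrooted (𝓓 i ℬ) \ downCore (𝓓 i ℬ) ⊆ unrooted ℬ := by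
  intro P hP
  obtain ⟨hPu, hPc⟩ := mem_sdiff.1 hP
  obtain ⟨j, hj, h⟩ := mem_unrooted.1 hPu
  rw [rootedAt_insert] at h
  have hij : i ≠ j := by
    rintro rfl
    refine hPc (mem_downCore.2 fun C hC => ?_)
    exact Down.mem_compression_of_insert_mem_compression (h C hC)
  refine mem_unrooted.2 ⟨j, hj, rootedAt_insert.2 fun C hC => ?_⟩
  by_cases hi : i ∈ P
  · have h1 := h (insert i C) (insert_subset hi hC)
    rw [mem_compression_iff_of_mem (by simp)] at h1
    by_cases hiC : i ∈ C
    · rw [insert_eq_of_mem hiC] at h1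
      exact h1.1
    · rw [erase_insert_of_ne hij.symm, erase_insert hiC] at h1
      exact h1.2
  · by_contra hC'
    obtain ⟨D, hDP, hD⟩ : ∃ D ⊆ P, D ∉ 𝓓 i ℬ := by
      simpa [mem_downCore] using hPc
    have hiD : i ∉ D := fun h' => hi (hDP h')
    rw [mem_compression_iff_of_notMem hiD, not_or] at hD
    obtain ⟨B, hB, hCB, hDB, hBsub⟩ : ∃ B ∈ ℬ, insert j C ⊆ B ∧ D ⊆ B ∧
        B ⊆ insert i (insert j (D ∪ C)) := by
      have hU := h (D ∪ C) (union_subset hDP hC)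
      have hiU : i ∉ insert j (D ∪ C) := by
        rw [mem_insert, mem_union, not_or, not_or]
        exact ⟨hij, hiD, fun h' => hi (hC h')⟩
      rcases (mem_compression_iff_of_notMem hiU).1 hU with hB | hB
      · exact ⟨_, hB, insert_subset_insert j subset_union_right,
          subset_union_left.trans (subset_insert j _), subset_insert i _⟩
      · exact ⟨_, hB, (insert_subset_insert j subset_union_right).trans (subset_insert i _),
          (subset_union_left.trans (subset_insert j _)).trans (subset_insert i _), Subset.rfl⟩
    obtain ⟨b, hb, hroot⟩ := hsr B hB ⟨j, hCB (mem_insert_self j C)⟩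
    have hroot : RootedAt ℬ B b := ⟨hb, hroot⟩
    have hb' := hBsub hb
    simp only [mem_insert, mem_union] at hb'
    rcases hb' with rfl | rfl | hb' | hb'
    · exact hD.2 (hroot.mem_of_subset (mem_insert_self b D) (insert_subset hb hDB))
    · exact hC' (hroot.mem_of_subset (mem_insert_self b C) hCB)
    · exact hD.1 (hroot.mem_of_subset hb' hDB)
    · exact hC' (hroot.mem_of_subset (mem_insert_of_mem hb') hCB)

theorem SimplyRooted.card_fallen_add_le {ℬ : Finset (Finset ℕ)} (hsr : SimplyRooted ℬ) (i : ℕ) :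
    (fallen i ℬ).card + (unrooted (𝓓 i ℬ) \ downCore (𝓓 i ℬ)).card ≤
      (unrooted ℬ \ downCore ℬ).card := by
  have hfallen : ∀ P ∈ fallen i ℬ, P ∈ unrooted ℬ ∧ P ∈ downCore (𝓓 i ℬ) := by
    intro P hP
    obtain ⟨hi, hP1, hP2⟩ := mem_fallen.1 hP
    have h := hsr.rootedAt_insert_of_notMem hP1 hP2
    exact ⟨mem_unrooted.2 ⟨i, hi, h⟩, h.mem_downCore_compression hi⟩
  rw [← card_union_of_disjoint]
  · refine card_le_card (union_subset (fun P hP => ?_) (fun P hP => ?_))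
    · exact mem_sdiff.2 ⟨(hfallen P hP).1, fun h =>
        (mem_fallen.1 hP).2.1 (mem_downCore.1 h P Subset.rfl)⟩
    · exact mem_sdiff.2 ⟨hsr.unrooted_compression_subset i hP,
        fun h => (mem_sdiff.1 hP).2 (downCore_subset_compression i ℬ h)⟩
  · exact disjoint_left.2 fun P hP hP' => (mem_sdiff.1 hP').2 (hfallen P hP).2

theorem downCore_eq_self {ℬ : Finset (Finset ℕ)} (h : ∀ i, fallen i ℬ = ∅) :
    downCore ℬ = ℬ := by
  refine Subset.antisymm (filter_subset _ _) fun B hB => mem_downCore.2 fun C hC => ?_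
  obtain ⟨D, rfl⟩ : ∃ D, C = B \ D := ⟨B \ C, (Finset.sdiff_sdiff_eq_self hC).symm⟩
  clear hC
  induction D using Finset.induction_on with
  | empty => simpa using hB
  | insert a D _ ih =>
    rw [sdiff_insert]
    by_contra hn
    have ha : a ∈ B \ D := by
      by_contra ha
      rw [erase_eq_of_notMem ha] at hn
      exact hn ih
    have := mem_fallen.2 ⟨notMem_erase a (B \ D), hn,
      by rwa [insert_erase ha]⟩
    simp [h a] at this

/-- Induction along down-compressions. -/
theorem compression_induction {motive : Finset (Finset ℕ) → Prop}
    (base : ∀ ℬ, downCore ℬ = ℬ → motive ℬ) (step : ∀ i ℬ, motive (𝓓 i ℬ) → motive ℬ)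
    (ℬ : Finset (Finset ℕ)) : motive ℬ := by
  induction hs : totalSize ℬ using Nat.strong_induction_on generalizing ℬ with
  | _ s ih =>
    subst hs
    by_cases h : ∀ i, fallen i ℬ = ∅
    · exact base ℬ (downCore_eq_self h)
    · push Not at h
      obtain ⟨i, hi⟩ := h
      have h1 := totalSize_compression i ℬ
      have h2 := card_pos.2 hi
      exact step i ℬ (ih _ (by omega) _ rfl)

theorem card_unrooted_le (ℬ : Finset (Finset ℕ)) : (unrooted ℬ).card ≤ ℬ.card := by
  refine (card_le_card subset_union_left).trans (b := (unrooted ℬ ∪ downCore ℬ).card) ?_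
  induction ℬ using compression_induction with
  | base ℬ h =>
    refine card_le_card (union_subset (fun P hP => ?_) (filter_subset _ _))
    obtain ⟨i, hi, hr⟩ := mem_unrooted.1 hP
    have := hr.mem
    rw [← h, mem_downCore] at this
    exact this P (subset_insert i P)
  | step i ℬ ih =>
    exact (card_le_card (unrooted_union_downCore_subset_compression i ℬ)).trans
      (ih.trans_eq (Down.card_compression i ℬ))

theorem innerEdges_add_sum (ℬ : Finset (Finset ℕ)) :
    innerEdges ℬ + ∑ B ∈ ℬ, (B.filter fun i => B.erase i ∉ ℬ).card = totalSize ℬ := by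
  rw [innerEdges, totalSize, ← sum_add_distrib]
  exact sum_congr rfl fun B _ => card_filter_add_card_filter_not _

theorem innerEdges_le_totalSize_colexInit (ℬ : Finset (Finset ℕ)) :
    innerEdges ℬ ≤ totalSize (colexInit ℬ.card) :=
  innerEdges_le (ℬ.biUnion id) ℬ fun _ hA => subset_biUnion_of_mem id hA

theorem SimplyRooted.totalSize_le_add_card_unrooted {ℬ : Finset (Finset ℕ)}
    (hsr : SimplyRooted ℬ) :
    totalSize ℬ ≤ totalSize (colexInit ℬ.card) + (unrooted ℬ).card := by
  suffices totalSize ℬ ≤ totalSize (colexInit ℬ.card) + (unrooted ℬ \ downCore ℬ).card from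
    this.trans (Nat.add_le_add_left (card_le_card sdiff_subset) _)
  induction ℬ using compression_induction with
  | base ℬ h =>
    have h1 := innerEdges_le_totalSize_colexInit ℬ
    have h2 := innerEdges_add_sum ℬ
    rw [sum_eq_zero] at h2
    · omega
    · intro B hB
      rw [card_eq_zero, filter_eq_empty_iff]
      intro i _ hi
      rw [← h, mem_downCore] at hB
      exact hi (hB _ (erase_subset i B))
  | step i ℬ ih =>
    have h1 := ih (hsr.compression i)
    have h2 := totalSize_compression i ℬ
    have h3 := hsr.card_fallen_add_le i
    rw [Down.card_compression] at h1
    omega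

/-- Sets rooted at two distinct elements, and the empty set, save one unit each. -/
theorem SimplyRooted.totalSize_add_card_le {ℬ 𝒬 : Finset (Finset ℕ)} (hsr : SimplyRooted ℬ)
    (h𝒬 : 𝒬 ⊆ ℬ) (hroots : ∀ B ∈ 𝒬, B.Nonempty →
      ∃ i j, i ≠ j ∧ RootedAt ℬ B i ∧ RootedAt ℬ B j) :
    totalSize ℬ + 𝒬.card ≤ totalSize (colexInit ℬ.card) + ℬ.card := by
  have h1 := innerEdges_le_totalSize_colexInit ℬ
  have h2 := innerEdges_add_sum ℬ
  have h3 : ∑ B ∈ ℬ, (B.filter fun i => B.erase i ∉ ℬ).card ≤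
      ∑ B ∈ ℬ, if B ∈ ℬ \ 𝒬 then 1 else 0 := by
    refine sum_le_sum fun B hB => ?_
    have key : ∀ {b c}, RootedAt ℬ B b → B.erase c ∉ ℬ → c = b := by
      intro b c hb hc
      by_contra hcb
      exact hc (hb.mem_of_subset (mem_erase.2 ⟨fun h => hcb h.symm, hb.1⟩) (erase_subset c B))
    split_ifs with hB'
    · refine card_le_one.2 fun x hx y hy => ?_
      rw [mem_filter] at hx hy
      obtain ⟨b, hb⟩ := hsr B hB ⟨x, hx.1⟩
      exact (key hb hx.2).trans (key hb hy.2).symm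
    · have hBQ : B ∈ 𝒬 := by
        by_contra h
        exact hB' (mem_sdiff.2 ⟨hB, h⟩)
      rw [Nat.le_zero, card_eq_zero, filter_eq_empty_iff]
      intro x hx hx'
      obtain ⟨i, j, hij, hi, hj⟩ := hroots B hBQ ⟨x, hx⟩
      exact hij ((key hi hx').symm.trans (key hj hx'))
  rw [← card_filter, filter_mem_eq_inter, inter_eq_right.2 sdiff_subset,
    card_sdiff_of_subset h𝒬] at h3
  have h4 := card_le_card h𝒬
  omega

theorem rootedFam_subset (ℬ : Finset (Finset ℕ)) (S : Finset ℕ) : rootedFam ℬ S ⊆ ℬ :=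
  filter_subset _ _

theorem RootedAt.rootedFam {ℬ : Finset (Finset ℕ)} {B S : Finset ℕ} {i : ℕ}
    (h : RootedAt ℬ B i) (hi : i ∈ S) : RootedAt (rootedFam ℬ S) B i := by
  refine ⟨h.1, fun C hiC hCB => ?_⟩
  have hC := h.mono (singleton_subset_iff.1 hiC) hCB
  exact mem_filter.2 ⟨hC.mem, i, hi, hC⟩

theorem unrooted_subset_of_subset {ℬ : Finset (Finset ℕ)} {s : Finset ℕ}
    (hs : ∀ B ∈ ℬ, B ⊆ s) : ∀ P ∈ unrooted ℬ, P ⊆ s := by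
  intro P hP
  obtain ⟨i, -, h⟩ := mem_unrooted.1 hP
  exact (subset_insert i P).trans (hs _ h.mem)

theorem unrooted_subset_union {ℬ : Finset (Finset ℕ)} {S T : Finset ℕ}
    (hs : ∀ B ∈ ℬ, B ⊆ S ∪ T) :
    unrooted ℬ ⊆ unrooted (rootedFam ℬ S) ∪ unrooted (rootedFam ℬ T) := by
  intro P hP
  obtain ⟨i, hi, h⟩ := mem_unrooted.1 hP
  rcases mem_union.1 (hs _ h.mem (mem_insert_self i P)) with hS | hT
  · exact mem_union_left _ (mem_unrooted.2 ⟨i, hi, h.rootedFam hS⟩)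
  · exact mem_union_right _ (mem_unrooted.2 ⟨i, hi, h.rootedFam hT⟩)

theorem empty_notMem_rootedFam (ℬ : Finset (Finset ℕ)) (S : Finset ℕ) : ∅ ∉ rootedFam ℬ S := by
  intro h
  obtain ⟨-, i, -, hi⟩ := mem_filter.1 h
  exact notMem_empty i hi.1

theorem SimplyRooted.rootedFam_union {ℬ : Finset (Finset ℕ)} (hsr : SimplyRooted ℬ)
    {S T : Finset ℕ} (hs : ∀ B ∈ ℬ, B ⊆ S ∪ T) :
    rootedFam ℬ S ∪ rootedFam ℬ T = ℬ.erase ∅ := by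
  ext B
  rw [mem_erase]
  constructor
  · intro hB
    refine ⟨?_, union_subset (rootedFam_subset ℬ S) (rootedFam_subset ℬ T) hB⟩
    rintro rfl
    rcases mem_union.1 hB with h | h <;> exact empty_notMem_rootedFam _ _ h
  · rintro ⟨hne, hB⟩
    obtain ⟨b, hb⟩ := hsr B hB (nonempty_iff_ne_empty.2 hne)
    rcases mem_union.1 (hs B hB hb.1) with h | h
    · exact mem_union_left _ (mem_filter.2 ⟨hB, b, h, hb⟩)
    · exact mem_union_right _ (mem_filter.2 ⟨hB, b, h, hb⟩)

theorem SimplyRooted.totalSize_add_card_inter_rootedFam_le {ℬ : Finset (Finset ℕ)}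
    (hsr : SimplyRooted ℬ) {S T : Finset ℕ} (hST : Disjoint S T) :
    totalSize ℬ + (rootedFam ℬ S ∩ rootedFam ℬ T).card + (if ∅ ∈ ℬ then 1 else 0) ≤
      totalSize (colexInit ℬ.card) + ℬ.card := by
  have hroots : ∀ B ∈ rootedFam ℬ S ∩ rootedFam ℬ T,
      ∃ i j, i ≠ j ∧ RootedAt ℬ B i ∧ RootedAt ℬ B j := by
    intro B hB
    obtain ⟨hBS, hBT⟩ := mem_inter.1 hB
    obtain ⟨-, i, hi, hri⟩ := mem_filter.1 hBS
    obtain ⟨-, j, hj, hrj⟩ := mem_filter.1 hBT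
    exact ⟨i, j, fun h => disjoint_left.1 hST hi (h ▸ hj), hri, hrj⟩
  have hsub : rootedFam ℬ S ∩ rootedFam ℬ T ⊆ ℬ :=
    inter_subset_left.trans (rootedFam_subset ℬ S)
  split_ifs with h
  · have h1 := hsr.totalSize_add_card_le (insert_subset h hsub) fun B hB hne =>
      hroots B ((mem_insert.1 hB).resolve_left hne.ne_empty)
    rwa [card_insert_of_notMem fun h' => empty_notMem_rootedFam ℬ S (mem_inter.1 h').1,
      ← add_assoc] at h1
  · exact hsr.totalSize_add_card_le hsub fun B hB _ => hroots B hB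

theorem SimplyRooted.card_rootedFam_add_card_rootedFam {ℬ : Finset (Finset ℕ)}
    (hsr : SimplyRooted ℬ) {S T : Finset ℕ} (hs : ∀ B ∈ ℬ, B ⊆ S ∪ T) :
    (rootedFam ℬ S).card + (rootedFam ℬ T).card + (if ∅ ∈ ℬ then 1 else 0) =
      ℬ.card + (rootedFam ℬ S ∩ rootedFam ℬ T).card := by
  rw [← card_union_add_card_inter, hsr.rootedFam_union hs]
  split_ifs with h
  · rw [← card_erase_add_one h]
    ring
  · rw [erase_eq_of_notMem h, add_zero]

/-- Splitting the ground set into `S` and `T` improves the bound on the total size by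
half of `|ℬ_S| |ℬ_T| / 2 ^ n`. -/
theorem SimplyRooted.totalSize_add_mul_le {ℬ : Finset (Finset ℕ)} (hsr : SimplyRooted ℬ)
    {S T : Finset ℕ} (hST : Disjoint S T) (hs : ∀ B ∈ ℬ, B ⊆ S ∪ T) :
    (totalSize ℬ : ℝ) +
        ((rootedFam ℬ S).card * (rootedFam ℬ T).card : ℝ) / (2 * 2 ^ (S ∪ T).card) +
        (if ∅ ∈ ℬ then 1 else 0) ≤
      totalSize (colexInit ℬ.card) + ℬ.card := by
  have hsub : ∀ R : Finset ℕ, ∀ B ∈ rootedFam ℬ R, B ⊆ S ∪ T :=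
    fun R B hB => hs B (rootedFam_subset ℬ R hB)
  have hharris := (isLowerSet_unrooted (rootedFam ℬ S)).le_card_inter_finset'
    (isLowerSet_unrooted (rootedFam ℬ T)) (unrooted_subset_of_subset (hsub S))
    (unrooted_subset_of_subset (hsub T))
  have hle : ∀ R : Finset ℕ, (rootedFam ℬ R).card ≤ 2 ^ (S ∪ T).card := fun R => by
    rw [← card_powerset]
    exact card_le_card fun B hB => mem_powerset.2 (hsub R B hB)
  have hunion := (card_le_card (unrooted_subset_union hs)).trans_eq (card_union _ _)
  have hcu := card_union_add_card_inter (unrooted (rootedFam ℬ S)) (unrooted (rootedFam ℬ T))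
  have h1 := hsr.totalSize_le_add_card_unrooted
  have h2 := hsr.totalSize_add_card_inter_rootedFam_le hST
  have h3 := hsr.card_rootedFam_add_card_rootedFam hs
  have hS := card_unrooted_le (rootedFam ℬ S)
  have hT := card_unrooted_le (rootedFam ℬ T)
  have h4 : 2 * totalSize ℬ + 2 * (if ∅ ∈ ℬ then 1 else 0) +
      (unrooted (rootedFam ℬ S) ∩ unrooted (rootedFam ℬ T)).card +
      ((rootedFam ℬ S).card - (unrooted (rootedFam ℬ S)).card) +
      ((rootedFam ℬ T).card - (unrooted (rootedFam ℬ T)).card) ≤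
      2 * totalSize (colexInit ℬ.card) + 2 * ℬ.card := by
    split_ifs at h2 h3 ⊢ <;> omega
  have hleS := hle S
  have hleT := hle T
  clear h1 h2 h3 hunion hcu hle
  generalize (unrooted (rootedFam ℬ S)).card = u at *
  generalize (unrooted (rootedFam ℬ T)).card = v at *
  generalize (unrooted (rootedFam ℬ S) ∩ unrooted (rootedFam ℬ T)).card = c at *
  generalize (rootedFam ℬ S).card = x at *
  generalize (rootedFam ℬ T).card = y at *
  have hN : (0 : ℝ) < 2 ^ (S ∪ T).card := by positivity
  obtain ⟨a, rfl⟩ := Nat.exists_eq_add_of_le hS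
  obtain ⟨b, rfl⟩ := Nat.exists_eq_add_of_le hT
  simp only [Nat.add_sub_cancel_left] at h4
  have h5 : (((u + a : ℕ) : ℝ) * ((v + b : ℕ) : ℝ)) / 2 ^ (S ∪ T).card ≤ c + a + b := by
    rw [div_le_iff₀ hN]
    have h6 : (u + a) * (v + b) ≤ 2 ^ (S ∪ T).card * (c + a + b) := by
      calc (u + a) * (v + b) = u * v + a * (v + b) + u * b := by ring
        _ ≤ 2 ^ (S ∪ T).card * c + a * 2 ^ (S ∪ T).card + 2 ^ (S ∪ T).card * b := by
          gcongr
          exact (Nat.le_add_right u a).trans hleS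
        _ = _ := by ring
    rw [mul_comm (2 ^ _)] at h6
    exact_mod_cast h6
  have h7 : (2 * totalSize ℬ + 2 * (if ∅ ∈ ℬ then 1 else 0) + c + a + b : ℝ) ≤
      2 * totalSize (colexInit ℬ.card) + 2 * ℬ.card := by
    exact_mod_cast h4
  have h8 : (((u + a : ℕ) : ℝ) * ((v + b : ℕ) : ℝ)) / (2 * 2 ^ (S ∪ T).card) =
      (((u + a : ℕ) : ℝ) * ((v + b : ℕ) : ℝ)) / 2 ^ (S ∪ T).card / 2 := by
    rw [mul_comm 2, div_div]
  rw [h8]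
  linarith

theorem card_rootedFam_union_le (ℬ : Finset (Finset ℕ)) (S T : Finset ℕ) :
    (rootedFam ℬ (S ∪ T)).card ≤ (rootedFam ℬ S).card + (rootedFam ℬ T).card := by
  refine (card_le_card fun B hB => ?_).trans (card_union_le _ _)
  obtain ⟨hB, i, hi, h⟩ := mem_filter.1 hB
  rcases mem_union.1 hi with hi | hi
  · exact mem_union_left _ (mem_filter.2 ⟨hB, i, hi, h⟩)
  · exact mem_union_right _ (mem_filter.2 ⟨hB, i, hi, h⟩)

/-- Some initial interval roots a proportion of `ℬ` between `(1 - p) / 2` and `(1 + p) / 2`. -/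
theorem exists_card_rootedFam_mem_Icc {ℬ : Finset (Finset ℕ)} {n : ℕ} {p m : ℝ} (hp : 0 ≤ p)
    (hm : 0 ≤ m) (hdeg : ∀ i ∈ Finset.Icc 1 n, ((rootedFam ℬ {i}).card : ℝ) ≤ p * m)
    (htop : (1 - p) / 2 * m ≤ (rootedFam ℬ (Finset.Icc 1 n)).card) :
    ∃ k ≤ n, ((rootedFam ℬ (Finset.Icc 1 k)).card : ℝ) ∈
      Set.Icc ((1 - p) / 2 * m) ((1 + p) / 2 * m) := by
  have hex : ∃ k, (1 - p) / 2 * m ≤ (rootedFam ℬ (Finset.Icc 1 k)).card := ⟨n, htop⟩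
  refine ⟨Nat.find hex, Nat.find_min' hex htop, Nat.find_spec hex, ?_⟩
  have hle := Nat.find_min' hex htop
  rcases hk : Nat.find hex with _ | k
  · have : rootedFam ℬ (Finset.Icc 1 0) = ∅ := by simp [rootedFam]
    rw [this, card_empty, Nat.cast_zero]
    positivity
  · have h1 := not_le.1 (Nat.find_min hex (m := k) (by omega))
    have h2 : Finset.Icc 1 (k + 1) = Finset.Icc 1 k ∪ {k + 1} := by
      ext x
      simp only [mem_union, Finset.mem_Icc, mem_singleton]
      omega
    have h3 := card_rootedFam_union_le ℬ (Finset.Icc 1 k) {k + 1}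
    rw [← h2] at h3
    have h4 := hdeg (k + 1) (Finset.mem_Icc.2 (by omega))
    have h5 : ((rootedFam ℬ (Finset.Icc 1 (k + 1))).card : ℝ) ≤
        (rootedFam ℬ (Finset.Icc 1 k)).card + (rootedFam ℬ {k + 1}).card := by
      exact_mod_cast h3
    linarith

/-- If `ℬ ⊆ 𝒫(n)` is simply rooted with `|ℬ| = m`, `p ∈ [0,1]`
and `|ℬ_{{i}}| ≤ p·m` for all `i ∈ [n]`, then
`‖ℬ‖ ≤ ‖I(m)‖ + m - m²(1/8 - p²/8)/2^n`. -/
theorem stmt7 (n : ℕ) (ℬ : Finset (Finset ℕ)) (hsub : ℬ ⊆ (Finset.Icc 1 n).powerset)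
    (hsr : SimplyRooted ℬ) (m : ℕ) (hm : m = ℬ.card)
    (p : ℝ) (hp : p ∈ Set.Icc (0 : ℝ) 1)
    (hdeg : ∀ i ∈ Finset.Icc 1 n, ((rootedFam ℬ {i}).card : ℝ) ≤ p * m) :
    (totalSize ℬ : ℝ) ≤ (totalSize (colexInit m) : ℝ) + m
      - (m : ℝ) ^ 2 * (1 / 8 - p ^ 2 / 8) / 2 ^ n := by
  subst hm
  obtain ⟨hp0, hp1⟩ := hp
  have hsub' : ∀ B ∈ ℬ, B ⊆ Finset.Icc 1 n := fun B hB => mem_powerset.1 (hsub hB)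
  have hN : (1 : ℝ) ≤ 2 ^ n := one_le_pow₀ one_le_two
  have hmN : (ℬ.card : ℝ) ≤ 2 ^ n := by
    have h := card_le_card hsub
    rw [card_powerset, Nat.card_Icc, Nat.add_sub_cancel] at h
    exact_mod_cast h
  have hq : 0 ≤ 1 / 8 - p ^ 2 / 8 := by nlinarith
  by_cases hℬ : ℬ = {∅}
  · subst hℬ
    have hsize : totalSize {∅} = 0 := by simp [totalSize]
    have hfrac : (1 / 8 - p ^ 2 / 8) / 2 ^ n ≤ 1 := by
      rw [div_le_one (by positivity)]
      nlinarith
    rw [hsize]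
    simp only [card_singleton, Nat.cast_zero, Nat.cast_one, one_pow, one_mul]
    have := Nat.cast_nonneg (α := ℝ) (totalSize (colexInit 1))
    linarith
  have htop : (1 - p) / 2 * (ℬ.card : ℝ) ≤ (rootedFam ℬ (Finset.Icc 1 n)).card := by
    have h1 : rootedFam ℬ (Finset.Icc 1 n) = ℬ.erase ∅ := by
      have := hsr.rootedFam_union (S := Finset.Icc 1 n) (T := Finset.Icc 1 n)
        (by simpa using hsub')
      rwa [union_idempotent] at this
    have h2 : ℬ.card ≤ 2 * (ℬ.erase ∅).card := by
      by_cases he : ∅ ∈ ℬ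
      · have hne : (ℬ.erase ∅).Nonempty := by
          rw [nonempty_iff_ne_empty, Ne, erase_eq_empty_iff]
          rintro (h | h)
          · simp [h] at he
          · exact hℬ h
        have := card_pos.2 hne
        have := card_erase_add_one he
        omega
      · rw [erase_eq_of_notMem he]
        omega
    have h3 : (ℬ.card : ℝ) ≤ 2 * ((ℬ.erase ∅).card : ℝ) := by exact_mod_cast h2
    rw [h1]
    nlinarith [Nat.cast_nonneg (α := ℝ) ℬ.card]
  obtain ⟨k, hkn, hk1, hk2⟩ :=
    exists_card_rootedFam_mem_Icc hp0 (Nat.cast_nonneg ℬ.card) hdeg htop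
  have hunion : Finset.Icc 1 k ∪ Finset.Icc (k + 1) n = Finset.Icc 1 n := by
    ext x
    simp only [mem_union, Finset.mem_Icc]
    omega
  have hdisj : Disjoint (Finset.Icc 1 k) (Finset.Icc (k + 1) n) := by
    refine disjoint_left.2 fun x hx hx' => ?_
    rw [Finset.mem_Icc] at hx hx'
    omega
  have hcover : ∀ B ∈ ℬ, B ⊆ Finset.Icc 1 k ∪ Finset.Icc (k + 1) n := by rwa [hunion]
  have hmain := hsr.totalSize_add_mul_le hdisj hcover
  have hcard := hsr.card_rootedFam_add_card_rootedFam hcover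
  have hxN : ((rootedFam ℬ (Finset.Icc 1 k)).card : ℝ) ≤ 2 ^ n :=
    le_trans (by exact_mod_cast card_le_card (rootedFam_subset ℬ _)) hmN
  rw [hunion, Nat.card_Icc, Nat.add_sub_cancel] at hmain
  have hsum : (ℬ.card : ℝ) ≤ (rootedFam ℬ (Finset.Icc 1 k)).card +
      (rootedFam ℬ (Finset.Icc (k + 1) n)).card + (if ∅ ∈ ℬ then 1 else 0) := by
    exact_mod_cast (Nat.le_add_right _ _).trans_eq hcard.symm
  have he : (0 : ℝ) ≤ if ∅ ∈ ℬ then 1 else 0 := by split_ifs <;> norm_num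
  have hx0 : (0 : ℝ) ≤ (rootedFam ℬ (Finset.Icc 1 k)).card := Nat.cast_nonneg _
  generalize (if ∅ ∈ ℬ then (1 : ℝ) else 0) = e at *
  generalize ((rootedFam ℬ (Finset.Icc 1 k)).card : ℝ) = x at *
  generalize ((rootedFam ℬ (Finset.Icc (k + 1) n)).card : ℝ) = y at *
  generalize (ℬ.card : ℝ) = m at *
  have hprod : m ^ 2 * (1 / 8 - p ^ 2 / 8) / 2 ^ n ≤ x * y / (2 * 2 ^ n) + e := by
    have h1 : m ^ 2 * (1 - p ^ 2) / 4 ≤ x * (m - x) := by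
      nlinarith [mul_nonneg (sub_nonneg.2 hk1) (sub_nonneg.2 hk2)]
    have h2 : x * (m - x) ≤ x * (y + e) := mul_le_mul_of_nonneg_left (by linarith) hx0
    have h3 : x * e ≤ 2 ^ n * e := mul_le_mul_of_nonneg_right hxN he
    have h4 : 0 ≤ 2 ^ n * e := mul_nonneg (by positivity) he
    rw [div_add' _ _ _ (by positivity), div_le_div_iff₀ (by positivity) (by positivity)]
    have h5 : m ^ 2 * (1 / 8 - p ^ 2 / 8) * 2 ≤ x * y + e * (2 * 2 ^ n) := by linarith
    have h6 := mul_le_mul_of_nonneg_right h5 (zero_le_one.trans hN)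
    linarith
  linarith
end

section
/- Let ℬ ⊆ 𝒫(n) be a simply rooted family. Then (1) d(ℬ) is a down-set, and (2) for every 1 ≤ k ≤ n, D_k(ℬ) is a simply rooted family. -/
open Finset
open scoped Classical

theorem mem_dComp_of_notMem {ℬ : Finset (Finset ℕ)} {i : ℕ} {A : Finset ℕ} (h : i ∉ A) :
    A ∈ dComp i ℬ ↔ A ∈ ℬ ∨ insert i A ∈ ℬ := by
  unfold dComp compressSet
  rw [mem_image]
  constructor
  · rintro ⟨B, hB, rfl⟩
    split_ifs with hc
    · right
      rwa [insert_erase hc.1]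
    · exact Or.inl hB
  · intro hA
    by_cases hm : A ∈ ℬ
    · exact ⟨A, hm, if_neg fun hc => h hc.1⟩
    · refine ⟨insert i A, hA.resolve_left hm, ?_⟩
      rw [erase_insert h, if_pos ⟨mem_insert_self i A, hm⟩]

theorem mem_dComp_of_mem {ℬ : Finset (Finset ℕ)} {i : ℕ} {A : Finset ℕ} (h : i ∈ A) :
    A ∈ dComp i ℬ ↔ A ∈ ℬ ∧ A.erase i ∈ ℬ := by
  unfold dComp compressSet
  rw [mem_image]
  constructor
  · rintro ⟨B, hB, rfl⟩
    split_ifs at h ⊢ with hc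
    · exact absurd h (notMem_erase i B)
    · exact ⟨hB, by_contra fun hn => hc ⟨h, hn⟩⟩
  · rintro ⟨hA, he⟩
    exact ⟨A, hA, if_neg fun hc => hc.2 he⟩

theorem SimplyRooted.dComp {ℬ : Finset (Finset ℕ)} (hℬ : SimplyRooted ℬ) (i : ℕ) :
    SimplyRooted (dComp i ℬ) := by
  intro A hA hne
  by_cases hi : i ∈ A
  · obtain ⟨hA, he⟩ := (mem_dComp_of_mem hi).1 hA
    obtain ⟨b, hb, hcube⟩ := hℬ A hA hne
    simp only [singleton_subset_iff] at hcube ⊢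
    by_cases hbi : b = i
    · subst hbi
      rcases (A.erase b).eq_empty_or_nonempty with h0 | h0
      · refine ⟨b, hb, fun C hbC hC => (mem_dComp_of_mem hbC).2 ⟨hcube C hbC hC, ?_⟩⟩
        have hCe : C.erase b ⊆ A.erase b := erase_subset_erase b hC
        rw [h0] at hCe he
        rwa [subset_empty.1 hCe]
      · obtain ⟨c, hc, hcube'⟩ := hℬ _ he h0
        simp only [singleton_subset_iff] at hcube'
        refine ⟨c, mem_of_mem_erase hc, fun C hcC hC => ?_⟩
        by_cases hbC : b ∈ C
        · exact (mem_dComp_of_mem hbC).2 ⟨hcube C hbC hC,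
            hcube' _ (mem_erase.2 ⟨ne_of_mem_erase hc, hcC⟩) (erase_subset_erase b hC)⟩
        · exact (mem_dComp_of_notMem hbC).2
            (Or.inl (hcube' C hcC (subset_erase.2 ⟨hC, hbC⟩)))
    · refine ⟨b, hb, fun C hbC hC => ?_⟩
      by_cases hiC : i ∈ C
      · exact (mem_dComp_of_mem hiC).2 ⟨hcube C hbC hC,
          hcube _ (mem_erase.2 ⟨hbi, hbC⟩) ((erase_subset i C).trans hC)⟩
      · exact (mem_dComp_of_notMem hiC).2 (Or.inl (hcube C hbC hC))
  · rcases (mem_dComp_of_notMem hi).1 hA with hA | hA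
    · obtain ⟨b, hb, hcube⟩ := hℬ A hA hne
      exact ⟨b, hb, fun C hbC hC =>
        (mem_dComp_of_notMem fun h => hi (hC h)).2 (Or.inl (hcube C hbC hC))⟩
    · obtain ⟨b, hb, hcube⟩ := hℬ _ hA (insert_nonempty i A)
      simp only [singleton_subset_iff] at hcube ⊢
      rcases mem_insert.1 hb with rfl | hb
      · obtain ⟨a, ha⟩ := hne
        exact ⟨a, ha, fun C _ hC => (mem_dComp_of_notMem fun h => hi (hC h)).2
          (Or.inr (hcube _ (mem_insert_self b C) (insert_subset_insert b hC)))⟩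
      · exact ⟨b, hb, fun C hbC hC => (mem_dComp_of_notMem fun h => hi (hC h)).2
          (Or.inl (hcube C hbC (hC.trans (subset_insert i A))))⟩

theorem SimplyRooted.DComp {ℬ : Finset (Finset ℕ)} (hℬ : SimplyRooted ℬ) (k : ℕ) :
    SimplyRooted (DComp k ℬ) := by
  induction k with
  | zero => exact hℬ
  | succ k ih => exact ih.dComp (k + 1)

theorem erase_mem_dComp_self {ℬ : Finset (Finset ℕ)} {i : ℕ} {A : Finset ℕ}
    (hA : A ∈ dComp i ℬ) : A.erase i ∈ dComp i ℬ := by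
  by_cases hi : i ∈ A
  · exact (mem_dComp_of_notMem (notMem_erase i A)).2 (Or.inl ((mem_dComp_of_mem hi).1 hA).2)
  · rwa [erase_eq_of_notMem hi]

/-- Down-compression in any direction preserves closure under removal of a fixed element. -/
theorem erase_mem_dComp {ℬ : Finset (Finset ℕ)} {i : ℕ} (hℬ : ∀ A ∈ ℬ, A.erase i ∈ ℬ) (j : ℕ)
    {A : Finset ℕ} (hA : A ∈ dComp j ℬ) : A.erase i ∈ dComp j ℬ := by
  by_cases hij : j = i
  · subst hij
    exact erase_mem_dComp_self hA
  by_cases hj : j ∈ A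
  · obtain ⟨hA, he⟩ := (mem_dComp_of_mem hj).1 hA
    refine (mem_dComp_of_mem (mem_erase.2 ⟨hij, hj⟩)).2 ⟨hℬ A hA, ?_⟩
    rw [erase_right_comm]
    exact hℬ _ he
  · refine (mem_dComp_of_notMem fun h => hj (mem_of_mem_erase h)).2 ?_
    rw [← erase_insert_of_ne hij]
    exact ((mem_dComp_of_notMem hj).1 hA).imp (hℬ A) (hℬ _)

theorem erase_mem_DComp {ℬ : Finset (Finset ℕ)} {k i : ℕ} (hi : 1 ≤ i) (hik : i ≤ k)
    {A : Finset ℕ} (hA : A ∈ DComp k ℬ) : A.erase i ∈ DComp k ℬ := by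
  induction k generalizing A with
  | zero => omega
  | succ k ih =>
    rcases hik.eq_or_lt with rfl | hlt
    · exact erase_mem_dComp_self hA
    · exact erase_mem_dComp (fun _ h => ih (by omega) h) (k + 1) hA

theorem dComp_subset_powerset {ℬ : Finset (Finset ℕ)} {S : Finset ℕ} (hℬ : ℬ ⊆ S.powerset)
    (i : ℕ) : dComp i ℬ ⊆ S.powerset := by
  intro A hA
  obtain ⟨B, hB, rfl⟩ := mem_image.1 hA
  have hBS := mem_powerset.1 (hℬ hB)
  unfold compressSet
  split_ifs
  · exact mem_powerset.2 ((erase_subset i B).trans hBS)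
  · exact mem_powerset.2 hBS

theorem DComp_subset_powerset {ℬ : Finset (Finset ℕ)} {S : Finset ℕ} (hℬ : ℬ ⊆ S.powerset)
    (k : ℕ) : DComp k ℬ ⊆ S.powerset := by
  induction k with
  | zero => exact hℬ
  | succ k ih => exact dComp_subset_powerset ih (k + 1)

theorem isDownSet_of_erase_mem {𝒟 : Finset (Finset ℕ)}
    (h : ∀ A ∈ 𝒟, ∀ i ∈ A, A.erase i ∈ 𝒟) : IsDownSet 𝒟 := by
  intro A hA B hBA
  have hsdiff : ∀ S : Finset ℕ, A \ S ∈ 𝒟 := by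
    intro S
    induction S using Finset.induction_on with
    | empty => rwa [sdiff_empty]
    | insert i S _ ih =>
      rw [sdiff_insert]
      by_cases hi : i ∈ A \ S
      · exact h _ ih i hi
      · rwa [erase_eq_of_notMem hi]
  rw [← Finset.sdiff_sdiff_eq_self hBA]
  exact hsdiff _

/-- For a simply rooted family `ℬ ⊆ 𝒫(n)`: (1) `d(ℬ)` is a
down-set, and (2) `D_k(ℬ)` is simply rooted for every `1 ≤ k ≤ n`. -/
theorem stmt8 (n : ℕ) (ℬ : Finset (Finset ℕ)) (hsub : ℬ ⊆ (Finset.Icc 1 n).powerset)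
    (hsr : SimplyRooted ℬ) :
    IsDownSet (DComp n ℬ) ∧ ∀ k, 1 ≤ k → k ≤ n → SimplyRooted (DComp k ℬ) := by
  refine ⟨isDownSet_of_erase_mem fun A hA i hi => ?_, fun k _ _ => hsr.DComp k⟩
  have hin := mem_Icc.1 (mem_powerset.1 (DComp_subset_powerset hsub n hA) hi)
  exact erase_mem_DComp hin.1 hin.2 hA
end
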